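/- Let i, j, r ∈ ℕ. In the field ℚ(q, t, u_0, u_1, u_2) of rational functions, C_{(i,j)}(u_0, u_1, u_2; 2, r) = ∇_{ij}(u_0, u_1, u_2) · (u_1/tu_0;q)_i/(qu_1/t²u_0;q)_i · (qtu_0/u_1;q)_r/(t²u_0/u_1;q)_r · (tu_0/u_1;q)_r/(qu_0/u_1;q)_r · (tu_2/u_0;q)_j/(qu_2/u_0;q)_j. -/

import Mathlib

open Finset

/-- The `q`-shifted factorial `(a;q)_m` for an integer index `m`. -/
noncomputable def qPoch {K : Type*} [Field K] (a q : K) (m : ℤ) : K :=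
  if 0 ≤ m then ∏ j ∈ Finset.range m.toNat, (1 - a * q ^ j)
  else (∏ j ∈ Finset.range (-m).toNat, (1 - a * q ^ (-(j : ℤ) - 1)))⁻¹

noncomputable abbrev K5 : Type := FractionRing (MvPolynomial (Fin 5) ℚ)

noncomputable def q5 : K5 := algebraMap (MvPolynomial (Fin 5) ℚ) K5 (MvPolynomial.X 0)
noncomputable def t5 : K5 := algebraMap (MvPolynomial (Fin 5) ℚ) K5 (MvPolynomial.X 1)
noncomputable def w0 : K5 := algebraMap (MvPolynomial (Fin 5) ℚ) K5 (MvPolynomial.X 2)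
noncomputable def w1 : K5 := algebraMap (MvPolynomial (Fin 5) ℚ) K5 (MvPolynomial.X 3)
noncomputable def w2 : K5 := algebraMap (MvPolynomial (Fin 5) ℚ) K5 (MvPolynomial.X 4)

/-- The coefficient `C_θ(u₀,u₁,u₂;k,r)` for `θ = (θ₁,θ₂) ∈ ℕ²`, `1 ≤ k ≤ 3`, `r ∈ ℕ`,
where `v₁ = q^{θ₁}u₁` and `v₂ = q^{θ₂}u₂`. -/
noncomputable def Cc (u₀ u₁ u₂ : K5) (k r θ₁ θ₂ : ℕ) : K5 :=
  let q := q5; let t := t5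
  let uu : Fin 2 → K5 := ![u₁, u₂]
  let th : Fin 2 → ℕ := ![θ₁, θ₂]
  let v : Fin 2 → K5 := ![q ^ θ₁ * u₁, q ^ θ₂ * u₂]
  q ^ (θ₁ + θ₂) *
    (qPoch (t ^ 2 * u₀) q (θ₁ + θ₂) / qPoch (q * t * u₀) q (θ₁ + θ₂)) *
    (∏ i : Fin 2, (qPoch (q / t) q (th i) / qPoch q q (th i)) *
      (qPoch (q * uu i) q (th i) / qPoch (q * t * uu i) q (th i))) *
    (qPoch (q * v 0 / (t * v 1)) q θ₂ / qPoch (q * v 0 / v 1) q θ₂) *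
    (qPoch (t * u₁ / v 1) q θ₂ / qPoch (u₁ / v 1) q θ₂) *
    (∏ i ∈ Finset.univ.filter (fun i : Fin 2 => (i : ℕ) + 1 < k),
      (qPoch (uu i / (t * u₀)) q (th i) / qPoch (q * uu i / (t ^ 2 * u₀)) q (th i)) *
        (qPoch (q * t * u₀ / uu i) q r / qPoch (t ^ 2 * u₀ / uu i) q r) *
        (qPoch (t * u₀ / uu i) q r / qPoch (q * u₀ / uu i) q r)) *
    (∏ i ∈ Finset.univ.filter (fun i : Fin 2 => k ≤ (i : ℕ) + 1),
      qPoch (t * uu i / u₀) q (th i) / qPoch (q * uu i / u₀) q (th i)) *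
    (v 0 - v 1)⁻¹ *
    Matrix.det (Matrix.of fun a b : Fin 2 =>
      v a ^ (2 - ((b : ℕ) + 1)) *
        (1 - t ^ (b : ℕ) * ((1 - t * v a) / (1 - v a)) *
          ((v a - u₁) / (v a - t * u₁)) * ((v a - u₂) / (v a - t * u₂))))

/-- The quantity `∇_{ij}(u₀,u₁,u₂)` for `(i,j) ∈ ℕ²`. -/
noncomputable def Nab (u₀ u₁ u₂ : K5) (i j : ℕ) : K5 :=
  let q := q5; let t := t5
  q ^ (i + j) * (qPoch (t ^ 2 * u₀) q (i + j) / qPoch (q * t * u₀) q (i + j)) *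
    (qPoch t⁻¹ q i / qPoch q q i) * (qPoch u₁ q i / qPoch (q * t * u₁) q i) *
    (qPoch t⁻¹ q j / qPoch q q j) * (qPoch u₂ q j / qPoch (q * t * u₂) q j) *
    (qPoch (q ^ ((i : ℤ) - j + 1) * u₁ / (t * u₂)) q j /
      qPoch (q ^ ((i : ℤ) - j + 1) * u₁ / u₂) q j) *
    (qPoch (t * q ^ (-(j : ℤ)) * u₁ / u₂) q j / qPoch (q ^ (-(j : ℤ)) * u₁ / u₂) q j) *
    (((1 - q ^ (2 * i) * u₁) / (1 - u₁)) * ((1 - q ^ (2 * j) * u₂) / (1 - u₂)) *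
        (1 + t⁻¹ * ((1 - q ^ i) / (1 - q ^ i * u₁ / (t * u₂))) *
          ((1 - q ^ j) / (1 - q ^ j * u₂ / (t * u₁))))
      - (q ^ i * u₁ + q ^ j * u₂) * ((1 - q ^ i) / (1 - u₁)) * ((1 - q ^ j) / (1 - u₂)) *
          ((1 - q ^ i / t) / (1 - q ^ i * u₁ / (t * u₂))) *
          ((1 - q ^ j / t) / (1 - q ^ j * u₂ / (t * u₁))))

theorem qPoch_natCast {K : Type*} [Field K] (a q : K) (n : ℕ) :
    qPoch a q n = ∏ j ∈ Finset.range n, (1 - a * q ^ j) := by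
  simp [qPoch]

/-- Shifting the base point of a `q`-shifted factorial by `q`. -/
theorem qPoch_mul_shift {K : Type*} [Field K] (a q : K) (n : ℕ) (ha : 1 - a ≠ 0) :
    qPoch (q * a) q n = qPoch a q n * ((1 - q ^ n * a) / (1 - a)) := by
  rw [mul_div_assoc', eq_div_iff ha, qPoch_natCast, qPoch_natCast, mul_comm (q ^ n) a,
    ← Finset.prod_range_succ (fun j => 1 - a * q ^ j), Finset.prod_range_succ']
  simp only [pow_zero, mul_one]
  congr 1
  exact Finset.prod_congr rfl fun j _ => by ring

/-- The two-variable determinant evaluation, with `x`, `y` in place of `q ^ i`, `q ^ j`. -/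
theorem det_div_sub_eq {K : Type*} [Field K] {t x y a b : K} (ht : t ≠ 0) (ht1 : t - 1 ≠ 0)
    (ha : a ≠ 0) (hb : b ≠ 0) (ha1 : 1 - a ≠ 0) (hb1 : 1 - b ≠ 0)
    (hxa : 1 - x * a ≠ 0) (hyb : 1 - y * b ≠ 0) (hv : x * a - y * b ≠ 0)
    (hx : x - t ≠ 0) (hy : y - t ≠ 0) (hxb : t * b - x * a ≠ 0) (hya : t * a - y * b ≠ 0) :
    ((1 - x * t⁻¹) / (1 - t⁻¹)) * ((1 - x * a) / (1 - a)) *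
      (((1 - y * t⁻¹) / (1 - t⁻¹)) * ((1 - y * b) / (1 - b))) * (x * a - y * b)⁻¹ *
      (x * a * (1 - (1 - t * (x * a)) / (1 - x * a) * ((x * a - a) / (x * a - t * a)) *
            ((x * a - b) / (x * a - t * b))) *
          (1 - t * ((1 - t * (y * b)) / (1 - y * b)) * ((y * b - a) / (y * b - t * a)) *
            ((y * b - b) / (y * b - t * b))) -
        (1 - t * ((1 - t * (x * a)) / (1 - x * a)) * ((x * a - a) / (x * a - t * a)) *
            ((x * a - b) / (x * a - t * b))) *
          (y * b * (1 - (1 - t * (y * b)) / (1 - y * b) * ((y * b - a) / (y * b - t * a)) *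
            ((y * b - b) / (y * b - t * b))))) =
    ((1 - x ^ 2 * a) / (1 - a)) * ((1 - y ^ 2 * b) / (1 - b)) *
        (1 + t⁻¹ * ((1 - x) / (1 - x * a / (t * b))) * ((1 - y) / (1 - y * b / (t * a))))
      - (x * a + y * b) * ((1 - x) / (1 - a)) * ((1 - y) / (1 - b)) *
          ((1 - x / t) / (1 - x * a / (t * b))) * ((1 - y / t) / (1 - y * b / (t * a))) := by
  have e1 : 1 - x * a / (t * b) = (t * b - x * a) / (t * b) := by field_simp
  have e2 : 1 - y * b / (t * a) = (t * a - y * b) / (t * a) := by field_simp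
  have e3 : x * a - t * a = a * (x - t) := by ring
  have e4 : y * b - t * b = b * (y - t) := by ring
  have e5 : x * a - t * b = -(t * b - x * a) := by ring
  have e6 : y * b - t * a = -(t * a - y * b) := by ring
  have e7 : 1 - t⁻¹ = (t - 1) / t := by field_simp
  have e8 : x * a - a = a * (x - 1) := by ring
  have e9 : y * b - b = b * (y - 1) := by ring
  rw [e1, e2, e3, e4, e5, e6, e7, e8, e9]
  field_simp
  ring

/-- A polynomial not vanishing at `(1, 2, 1, 3, 5)` is nonzero in the fraction field. -/
theorem algebraMap_ne_zero_of_eval (p : MvPolynomial (Fin 5) ℚ)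
    (h : MvPolynomial.eval ![1, 2, 1, 3, 5] p ≠ 0) :
    algebraMap (MvPolynomial (Fin 5) ℚ) K5 p ≠ 0 := by
  intro h0
  rw [map_eq_zero_iff _ (IsFractionRing.injective _ _)] at h0
  simp [h0] at h

theorem stmt_4 (i j r : ℕ) :
    Cc w0 w1 w2 2 r i j =
      Nab w0 w1 w2 i j *
        (qPoch (w1 / (t5 * w0)) q5 i / qPoch (q5 * w1 / (t5 ^ 2 * w0)) q5 i) *
        (qPoch (q5 * t5 * w0 / w1) q5 r / qPoch (t5 ^ 2 * w0 / w1) q5 r) *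
        (qPoch (t5 * w0 / w1) q5 r / qPoch (q5 * w0 / w1) q5 r) *
        (qPoch (t5 * w2 / w0) q5 j / qPoch (q5 * w2 / w0) q5 j) := by
  have hq : q5 ≠ 0 := algebraMap_ne_zero_of_eval _ (by simp)
  have ht : t5 ≠ 0 := algebraMap_ne_zero_of_eval _ (by simp)
  have ha : w1 ≠ 0 := algebraMap_ne_zero_of_eval _ (by simp)
  have hb : w2 ≠ 0 := algebraMap_ne_zero_of_eval _ (by simp)
  have ht1 : t5 - 1 ≠ 0 := by
    simpa [t5] using algebraMap_ne_zero_of_eval (.X 1 - 1) (by simp; norm_num)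
  have ha1 : 1 - w1 ≠ 0 := by
    simpa [w1] using algebraMap_ne_zero_of_eval (1 - .X 3) (by simp; norm_num)
  have hb1 : 1 - w2 ≠ 0 := by
    simpa [w2] using algebraMap_ne_zero_of_eval (1 - .X 4) (by simp; norm_num)
  have hxa : 1 - q5 ^ i * w1 ≠ 0 := by
    simpa [w1, q5] using algebraMap_ne_zero_of_eval (1 - .X 0 ^ i * .X 3) (by simp; norm_num)
  have hyb : 1 - q5 ^ j * w2 ≠ 0 := by
    simpa [w2, q5] using algebraMap_ne_zero_of_eval (1 - .X 0 ^ j * .X 4) (by simp; norm_num)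
  have hv : q5 ^ i * w1 - q5 ^ j * w2 ≠ 0 := by
    simpa [w1, w2, q5] using
      algebraMap_ne_zero_of_eval (.X 0 ^ i * .X 3 - .X 0 ^ j * .X 4) (by simp; norm_num)
  have hx : q5 ^ i - t5 ≠ 0 := by
    simpa [t5, q5] using algebraMap_ne_zero_of_eval (.X 0 ^ i - .X 1) (by simp; norm_num)
  have hy : q5 ^ j - t5 ≠ 0 := by
    simpa [t5, q5] using algebraMap_ne_zero_of_eval (.X 0 ^ j - .X 1) (by simp; norm_num)
  have hxb : t5 * w2 - q5 ^ i * w1 ≠ 0 := by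
    simpa [w1, w2, q5, t5] using
      algebraMap_ne_zero_of_eval (.X 1 * .X 4 - .X 0 ^ i * .X 3) (by simp; norm_num)
  have hya : t5 * w1 - q5 ^ j * w2 ≠ 0 := by
    simpa [w1, w2, q5, t5] using
      algebraMap_ne_zero_of_eval (.X 1 * .X 3 - .X 0 ^ j * .X 4) (by simp; norm_num)
  have hti : 1 - t5⁻¹ ≠ 0 := by
    have : 1 - t5⁻¹ = (t5 - 1) / t5 := by field_simp
    rw [this]; exact div_ne_zero ht1 ht
  have key := det_div_sub_eq ht ht1 ha hb ha1 hb1 hxa hyb hv hx hy hxb hya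
  have f1 : (Finset.univ.filter fun i : Fin 2 => (i : ℕ) + 1 < 2) = {0} := by decide
  have f2 : (Finset.univ.filter fun i : Fin 2 => 2 ≤ (i : ℕ) + 1) = {1} := by decide
  have a1 : q5 * (q5 ^ i * w1) / (t5 * (q5 ^ j * w2)) =
      q5 ^ ((i : ℤ) - j + 1) * w1 / (t5 * w2) := by
    rw [zpow_add₀ hq, zpow_sub₀ hq, zpow_natCast, zpow_natCast, zpow_one]; field_simp
  have a2 : q5 * (q5 ^ i * w1) / (q5 ^ j * w2) = q5 ^ ((i : ℤ) - j + 1) * w1 / w2 := by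
    rw [zpow_add₀ hq, zpow_sub₀ hq, zpow_natCast, zpow_natCast, zpow_one]; field_simp
  have a3 : t5 * w1 / (q5 ^ j * w2) = t5 * q5 ^ (-(j : ℤ)) * w1 / w2 := by
    rw [zpow_neg, zpow_natCast]; field_simp
  have a4 : w1 / (q5 ^ j * w2) = q5 ^ (-(j : ℤ)) * w1 / w2 := by
    rw [zpow_neg, zpow_natCast]; field_simp
  simp only [Cc, Nab, f1, f2, Finset.prod_singleton, Fin.prod_univ_two, Matrix.det_fin_two,
    Matrix.of_apply, Matrix.cons_val_zero, Matrix.cons_val_one, Fin.val_zero, Fin.val_one,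
    a1, a2, a3, a4]
  rw [div_eq_mul_inv q5 t5, qPoch_mul_shift _ _ i hti, qPoch_mul_shift _ _ j hti,
    qPoch_mul_shift _ _ i ha1, qPoch_mul_shift _ _ j hb1, mul_comm 2 i, mul_comm 2 j,
    pow_mul, pow_mul, ← key]
  norm_num only [pow_zero, pow_one, one_mul]
  ring
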